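/- arXiv:2006.11772 — 2 statements merged into one kernel-verified Lean document; each statement's English description precedes it below -/
import Mathlib

section
/- For all integers k1, k2 with k1 ≥ 2, k2 ≥ 2 and k1 ≠ k2, there exists an integer n0 such that for every n ≥ n0 there exists a connected simple graph G on n vertices with metric dimension dim(G) = k1 and edge metric dimension edim(G) = k2. -/
/-- `S` is a metric generator of `G`: every pair of distinct vertices is
identified by some vertex of `S` via distances. -/
def IsMetricGenerator {V : Type*} (G : SimpleGraph V) (S : Set V) : Prop :=
  ∀ u v : V, u ≠ v → ∃ z ∈ S, G.dist u z ≠ G.dist v z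

/-- The metric dimension of `G`: the least cardinality of a (finite) metric generator. -/
noncomputable def metricDim {V : Type*} (G : SimpleGraph V) : ℕ :=
  sInf {n | ∃ S : Set V, S.Finite ∧ IsMetricGenerator G S ∧ S.ncard = n}

/-- Distance from an edge (unordered pair) to a vertex:
`d(uv, z) = min (d u z) (d v z)`. -/
noncomputable def edgeDist {V : Type*} (G : SimpleGraph V) (e : Sym2 V) (z : V) : ℕ :=
  Sym2.lift ⟨fun u v => min (G.dist u z) (G.dist v z), fun u v => by simp [min_comm]⟩ e

/-- `S` is an edge metric generator of `G`: every pair of distinct edges is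
distinguished by some vertex of `S`. -/
def IsEdgeMetricGenerator {V : Type*} (G : SimpleGraph V) (S : Set V) : Prop :=
  ∀ e ∈ G.edgeSet, ∀ f ∈ G.edgeSet, e ≠ f → ∃ z ∈ S, edgeDist G e z ≠ edgeDist G f z

/-- The edge metric dimension of `G`: the least cardinality of a (finite) edge
metric generator. -/
noncomputable def edgeMetricDim {V : Type*} (G : SimpleGraph V) : ℕ :=
  sInf {n | ∃ S : Set V, S.Finite ∧ IsEdgeMetricGenerator G S ∧ S.ncard = n}

namespace RealizationDimEdim

open SimpleGraph

section General

variable {V : Type*} {G : SimpleGraph V}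

theorem exists_adj_dist_succ (hG : G.Connected) {x z : V} (h : x ≠ z) :
    ∃ y, G.Adj x y ∧ G.dist x z = G.dist y z + 1 := by
  obtain ⟨p, hp⟩ := hG.exists_walk_length_eq_dist x z
  cases p with
  | nil => exact absurd rfl h
  | @cons _ y _ hxy q =>
    refine ⟨y, hxy, ?_⟩
    have h1 : G.dist y z ≤ q.length := dist_le q
    have h2 : G.dist x z ≤ G.dist x y + G.dist y z := hG.dist_triangle
    rw [dist_eq_one_iff_adj.2 hxy] at h2
    rw [Walk.length_cons] at hp
    omega

theorem dist_le_dist_add_one (hG : G.Connected) {x y : V} (h : G.Adj x y) (z : V) :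
    G.dist x z ≤ G.dist y z + 1 := by
  have h2 : G.dist x z ≤ G.dist x y + G.dist y z := hG.dist_triangle
  rw [dist_eq_one_iff_adj.2 h] at h2
  omega

theorem exists_walk_length_eq {f : V → ℕ} {z : V}
    (hdec : ∀ x, x ≠ z → ∃ y, G.Adj x y ∧ f x = f y + 1) :
    ∀ k x, f x ≤ k → ∃ p : G.Walk x z, p.length ≤ f x := by
  intro k
  induction k with
  | zero =>
    intro x hx
    by_cases hxz : x = z
    · subst hxz
      exact ⟨Walk.nil, Nat.zero_le _⟩
    · obtain ⟨y, -, h⟩ := hdec x hxz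
      omega
  | succ k ih =>
    intro x hx
    by_cases hxz : x = z
    · subst hxz
      exact ⟨Walk.nil, Nat.zero_le _⟩
    · obtain ⟨y, hxy, h⟩ := hdec x hxz
      obtain ⟨p, hp⟩ := ih y (by omega)
      exact ⟨Walk.cons hxy p, by rw [Walk.length_cons]; omega⟩

theorem connected_of_descent {f : V → ℕ} {z : V}
    (hdec : ∀ x, x ≠ z → ∃ y, G.Adj x y ∧ f x = f y + 1) : G.Connected := by
  have hr : ∀ x, G.Reachable x z := fun x =>
    (exists_walk_length_eq hdec _ x le_rfl).elim fun p _ => p.reachable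
  have : Nonempty V := ⟨z⟩
  exact ⟨fun x y => (hr x).trans (hr y).symm⟩

/-- A function that is `1`-Lipschitz along edges, vanishes at `z` and admits descent towards `z`
is the distance to `z`. -/
theorem dist_eq_of_descent {f : V → ℕ} {z : V} (h0 : f z = 0)
    (hlip : ∀ x y, G.Adj x y → f x ≤ f y + 1)
    (hdec : ∀ x, x ≠ z → ∃ y, G.Adj x y ∧ f x = f y + 1) (x : V) : G.dist x z = f x := by
  apply le_antisymm
  · obtain ⟨p, hp⟩ := exists_walk_length_eq hdec _ x le_rfl
    exact (dist_le p).trans hp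
  · obtain ⟨p, hp⟩ := (connected_of_descent hdec).exists_walk_length_eq_dist x z
    rw [← hp]
    clear hp hdec
    induction p with
    | nil => simp [h0]
    | cons h q ih =>
      have := hlip _ _ h
      have := ih h0
      rw [Walk.length_cons]
      omega

theorem le_ncard_of_hits {S : Set V} (hS : S.Finite) (c : V → ℕ) {k : ℕ}
    (h : ∀ i < k, ∃ z ∈ S, c z = i) : k ≤ S.ncard := by
  have h1 : ((Finset.range k : Finset ℕ) : Set ℕ) ⊆ c '' S := by
    intro i hi
    exact h i (by simpa using hi)
  calc k = ((Finset.range k : Finset ℕ) : Set ℕ).ncard := by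
        rw [Set.ncard_coe_finset, Finset.card_range]
    _ ≤ (c '' S).ncard := Set.ncard_le_ncard h1 (hS.image c)
    _ ≤ S.ncard := Set.ncard_image_le hS

theorem sInf_ncard_eq {P : Set V → Prop} {k : ℕ} {S : Set V} (hS : S.Finite) (hP : P S)
    (hk : S.ncard ≤ k) (hlow : ∀ T : Set V, T.Finite → P T → k ≤ T.ncard) :
    sInf {n | ∃ S : Set V, S.Finite ∧ P S ∧ S.ncard = n} = k := by
  have hk' : k ∈ {n | ∃ S : Set V, S.Finite ∧ P S ∧ S.ncard = n} :=
    ⟨S, hS, hP, le_antisymm hk (hlow S hS hP)⟩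
  apply le_antisymm (Nat.sInf_le hk')
  apply le_csInf ⟨k, hk'⟩
  rintro n ⟨T, hT, hPT, rfl⟩
  exact hlow T hT hPT

theorem edgeDist_mk (a b z : V) : edgeDist G s(a, b) z = min (G.dist a z) (G.dist b z) := rfl

theorem ncard_pair_union_range_le {k : ℕ} (a b : V) (g : Fin k → V) :
    (insert a (insert b (Set.range g))).ncard ≤ k + 2 := by
  have h1 := Set.ncard_insert_le a (insert b (Set.range g))
  have h2 := Set.ncard_insert_le b (Set.range g)
  have h3 : (Set.range g).ncard ≤ k := by
    rw [← Set.image_univ]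
    refine (Set.ncard_image_le Set.finite_univ).trans ?_
    simp [Set.ncard_univ]
  omega

end General

/-- Vertices of the chain graph: a spine, two leaves at each end of the spine, `m` hexagons lying
on three consecutive spine vertices with a leaf at the middle one, and `k` triangles lying on two
consecutive spine vertices with a leaf at the first one. -/
inductive Vert (m k d : ℕ) : Type
  | spine (j : Fin (3 * m + 2 * k + 2 + d))
  | left (b : Bool)
  | right (b : Bool)
  | hexLeaf (i : Fin m)
  | hexTop (i : Fin m)
  | hexLeft (i : Fin m)
  | hexRight (i : Fin m)
  | triTop (i : Fin k)
  | triLeaf (i : Fin k)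

namespace Vert

variable {m k d : ℕ}

def equivSum (m k d : ℕ) : Vert m k d ≃
    Fin (3 * m + 2 * k + 2 + d) ⊕ Bool ⊕ Bool ⊕ Fin m ⊕ Fin m ⊕ Fin m ⊕ Fin m ⊕ Fin k ⊕ Fin k where
  toFun
    | spine j => .inl j
    | left b => .inr (.inl b)
    | right b => .inr (.inr (.inl b))
    | hexLeaf i => .inr (.inr (.inr (.inl i)))
    | hexTop i => .inr (.inr (.inr (.inr (.inl i))))
    | hexLeft i => .inr (.inr (.inr (.inr (.inr (.inl i)))))
    | hexRight i => .inr (.inr (.inr (.inr (.inr (.inr (.inl i))))))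
    | triTop i => .inr (.inr (.inr (.inr (.inr (.inr (.inr (.inl i)))))))
    | triLeaf i => .inr (.inr (.inr (.inr (.inr (.inr (.inr (.inr i)))))))
  invFun
    | .inl j => spine j
    | .inr (.inl b) => left b
    | .inr (.inr (.inl b)) => right b
    | .inr (.inr (.inr (.inl i))) => hexLeaf i
    | .inr (.inr (.inr (.inr (.inl i)))) => hexTop i
    | .inr (.inr (.inr (.inr (.inr (.inl i))))) => hexLeft i
    | .inr (.inr (.inr (.inr (.inr (.inr (.inl i)))))) => hexRight i
    | .inr (.inr (.inr (.inr (.inr (.inr (.inr (.inl i))))))) => triTop i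
    | .inr (.inr (.inr (.inr (.inr (.inr (.inr (.inr i))))))) => triLeaf i
  left_inv := by rintro (_ | _ | _ | _ | _ | _ | _ | _ | _) <;> rfl
  right_inv := by rintro (_ | _ | _ | _ | _ | _ | _ | _ | _) <;> rfl

instance : Fintype (Vert m k d) := Fintype.ofEquiv _ (equivSum m k d).symm

theorem card_eq : Fintype.card (Vert m k d) = 7 * m + 4 * k + 6 + d := by
  rw [Fintype.card_congr (equivSum m k d)]
  simp only [Fintype.card_sum, Fintype.card_fin, Fintype.card_bool]
  omega

/-- The edges of the chain graph, each with one orientation. -/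
inductive Arc : Vert m k d → Vert m k d → Prop
  | spine (i j : Fin (3 * m + 2 * k + 2 + d)) (h : (j : ℕ) = i + 1) : Arc (spine i) (spine j)
  | left (b : Bool) (j : Fin (3 * m + 2 * k + 2 + d)) (h : (j : ℕ) = 0) : Arc (left b) (spine j)
  | right (b : Bool) (j : Fin (3 * m + 2 * k + 2 + d)) (h : (j : ℕ) = 3 * m + 2 * k + 1 + d) :
      Arc (right b) (spine j)
  | hexLeaf (i : Fin m) (j : Fin (3 * m + 2 * k + 2 + d)) (h : (j : ℕ) = 3 * i + 2) :
      Arc (hexLeaf i) (spine j)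
  | hexLeft (i : Fin m) (j : Fin (3 * m + 2 * k + 2 + d)) (h : (j : ℕ) = 3 * i + 1) :
      Arc (hexLeft i) (spine j)
  | hexRight (i : Fin m) (j : Fin (3 * m + 2 * k + 2 + d)) (h : (j : ℕ) = 3 * i + 3) :
      Arc (hexRight i) (spine j)
  | hexTopLeft (i) : Arc (hexTop i) (hexLeft i)
  | hexTopRight (i) : Arc (hexTop i) (hexRight i)
  | triLeft (i : Fin k) (j : Fin (3 * m + 2 * k + 2 + d)) (h : (j : ℕ) = 3 * m + 2 * i + 1) :
      Arc (triTop i) (spine j)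
  | triRight (i : Fin k) (j : Fin (3 * m + 2 * k + 2 + d)) (h : (j : ℕ) = 3 * m + 2 * i + 2) :
      Arc (triTop i) (spine j)
  | triLeaf (i : Fin k) (j : Fin (3 * m + 2 * k + 2 + d)) (h : (j : ℕ) = 3 * m + 2 * i + 1) :
      Arc (triLeaf i) (spine j)

theorem Arc.ne {x y : Vert m k d} (h : Arc x y) : x ≠ y := by
  rintro rfl
  cases h
  omega

def graph (m k d : ℕ) : SimpleGraph (Vert m k d) where
  Adj x y := Arc x y ∨ Arc y x
  symm := ⟨fun _ _ h => h.symm⟩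
  loopless := ⟨fun _ h => h.elim (fun h => h.ne rfl) fun h => h.ne rfl⟩

theorem Arc.adj {x y : Vert m k d} (h : Arc x y) : (graph m k d).Adj x y := Or.inl h

/-- The distance to `left true`. -/
def toLeft : Vert m k d → ℕ
  | spine j => j + 1
  | left true => 0
  | left false => 2
  | right _ => 3 * m + 2 * k + d + 3
  | hexLeaf i => 3 * i + 4
  | hexTop i => 3 * i + 4
  | hexLeft i => 3 * i + 3
  | hexRight i => 3 * i + 5
  | triTop i => 3 * m + 2 * i + 3
  | triLeaf i => 3 * m + 2 * i + 3

/-- The distance to `right true`. -/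
def toRight : Vert m k d → ℕ
  | spine j => 3 * m + 2 * k + d + 2 - j
  | left _ => 3 * m + 2 * k + d + 3
  | right true => 0
  | right false => 2
  | hexLeaf i => 3 * m + 2 * k + d + 1 - 3 * i
  | hexTop i => 3 * m + 2 * k + d + 1 - 3 * i
  | hexLeft i => 3 * m + 2 * k + d + 2 - 3 * i
  | hexRight i => 3 * m + 2 * k + d - 3 * i
  | triTop i => 2 * k + d + 1 - 2 * i
  | triLeaf i => 2 * k + d + 2 - 2 * i

theorem toLeft_lipschitz {x y : Vert m k d} (h : Arc x y) :
    toLeft x ≤ toLeft y + 1 ∧ toLeft y ≤ toLeft x + 1 := by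
  rcases h with ⟨i, j, h⟩ | ⟨_ | _, j, h⟩ | ⟨b, j, h⟩ | ⟨i, j, h⟩ | ⟨i, j, h⟩ | ⟨i, j, h⟩ | i | i |
    ⟨i, j, h⟩ | ⟨i, j, h⟩ | ⟨i, j, h⟩ <;> simp only [toLeft] <;> omega

theorem toRight_lipschitz {x y : Vert m k d} (h : Arc x y) :
    toRight x ≤ toRight y + 1 ∧ toRight y ≤ toRight x + 1 := by
  rcases h with ⟨i, j, h⟩ | ⟨b, j, h⟩ | ⟨_ | _, j, h⟩ | ⟨i, j, h⟩ | ⟨i, j, h⟩ | ⟨i, j, h⟩ | i | i |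
    ⟨i, j, h⟩ | ⟨i, j, h⟩ | ⟨i, j, h⟩ <;> simp only [toRight] <;> omega

theorem toLeft_descent (x : Vert m k d) (hx : x ≠ left true) :
    ∃ y, (graph m k d).Adj x y ∧ toLeft x = toLeft y + 1 := by
  rcases x with ⟨_ | j, hj⟩ | ⟨_ | _⟩ | b | i | i | i | i | i | i
  · exact ⟨left true, Or.inr (.left _ _ rfl), rfl⟩
  · exact ⟨spine ⟨j, by omega⟩, Or.inr (.spine _ _ rfl), rfl⟩
  · exact ⟨spine ⟨0, by omega⟩, Or.inl (.left _ _ rfl), rfl⟩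
  · exact absurd rfl hx
  · exact ⟨spine ⟨3 * m + 2 * k + 1 + d, by omega⟩, Or.inl (.right _ _ rfl),
      by simp only [toLeft]; omega⟩
  · exact ⟨spine ⟨3 * i + 2, by omega⟩, Or.inl (.hexLeaf _ _ rfl), rfl⟩
  · exact ⟨hexLeft i, Or.inl (.hexTopLeft _), rfl⟩
  · exact ⟨spine ⟨3 * i + 1, by omega⟩, Or.inl (.hexLeft _ _ rfl), rfl⟩
  · exact ⟨spine ⟨3 * i + 3, by omega⟩, Or.inl (.hexRight _ _ rfl), rfl⟩
  · exact ⟨spine ⟨3 * m + 2 * i + 1, by omega⟩, Or.inl (.triLeft _ _ rfl), rfl⟩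
  · exact ⟨spine ⟨3 * m + 2 * i + 1, by omega⟩, Or.inl (.triLeaf _ _ rfl), rfl⟩

theorem toRight_descent (x : Vert m k d) (hx : x ≠ right true) :
    ∃ y, (graph m k d).Adj x y ∧ toRight x = toRight y + 1 := by
  rcases x with ⟨j, hj⟩ | b | ⟨_ | _⟩ | i | i | i | i | i | i
  · by_cases h : j = 3 * m + 2 * k + 1 + d
    · exact ⟨right true, Or.inr (.right _ _ h), by simp only [toRight]; omega⟩
    · exact ⟨spine ⟨j + 1, by omega⟩, Or.inl (.spine _ _ rfl), by simp only [toRight]; omega⟩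
  · exact ⟨spine ⟨0, by omega⟩, Or.inl (.left _ _ rfl), by simp only [toRight]; omega⟩
  · exact ⟨spine ⟨3 * m + 2 * k + 1 + d, by omega⟩, Or.inl (.right _ _ rfl),
      by simp only [toRight]; omega⟩
  · exact absurd rfl hx
  · exact ⟨spine ⟨3 * i + 2, by omega⟩, Or.inl (.hexLeaf _ _ rfl), by simp only [toRight]; omega⟩
  · exact ⟨hexRight i, Or.inl (.hexTopRight _), by simp only [toRight]; omega⟩
  · exact ⟨spine ⟨3 * i + 1, by omega⟩, Or.inl (.hexLeft _ _ rfl), by simp only [toRight]; omega⟩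
  · exact ⟨spine ⟨3 * i + 3, by omega⟩, Or.inl (.hexRight _ _ rfl), by simp only [toRight]; omega⟩
  · exact ⟨spine ⟨3 * m + 2 * i + 2, by omega⟩, Or.inl (.triRight _ _ rfl),
      by simp only [toRight]; omega⟩
  · exact ⟨spine ⟨3 * m + 2 * i + 1, by omega⟩, Or.inl (.triLeaf _ _ rfl),
      by simp only [toRight]; omega⟩

theorem connected : (graph m k d).Connected := connected_of_descent toLeft_descent

theorem dist_left (x : Vert m k d) : (graph m k d).dist x (left true) = toLeft x :=
  dist_eq_of_descent (G := graph m k d) rfl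
    (fun _ _ h => h.elim (fun h => (toLeft_lipschitz h).1) fun h => (toLeft_lipschitz h).2)
    toLeft_descent x

theorem dist_right (x : Vert m k d) : (graph m k d).dist x (right true) = toRight x :=
  dist_eq_of_descent (G := graph m k d) rfl
    (fun _ _ h => h.elim (fun h => (toRight_lipschitz h).1) fun h => (toRight_lipschitz h).2)
    toRight_descent x

theorem eq_or_hex_of_dist_eq {x y : Vert m k d} (h1 : toLeft x = toLeft y)
    (h2 : toRight x = toRight y) :
    x = y ∨ ∃ i, (x = hexLeaf i ∧ y = hexTop i) ∨ (x = hexTop i ∧ y = hexLeaf i) := by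
  rcases x with ⟨i, hi⟩ | ⟨_ | _⟩ | ⟨_ | _⟩ | ⟨i, hi⟩ | ⟨i, hi⟩ | ⟨i, hi⟩ | ⟨i, hi⟩ | ⟨i, hi⟩ |
      ⟨i, hi⟩ <;>
    rcases y with ⟨j, hj⟩ | ⟨_ | _⟩ | ⟨_ | _⟩ | ⟨j, hj⟩ | ⟨j, hj⟩ | ⟨j, hj⟩ | ⟨j, hj⟩ | ⟨j, hj⟩ |
      ⟨j, hj⟩ <;>
    simp only [toLeft, toRight] at h1 h2 <;>
    first
    | omega
    | exact Or.inl rfl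
    | (obtain rfl : i = j := by omega
       simp)

theorem isMetricGenerator :
    IsMetricGenerator (graph m k d)
      (insert (left true) (insert (right true) (Set.range hexLeaf))) := by
  intro x y hxy
  by_contra! h
  have h1 := h (left true) (by simp)
  have h2 := h (right true) (by simp)
  rw [dist_left, dist_left] at h1
  rw [dist_right, dist_right] at h2
  rcases eq_or_hex_of_dist_eq h1 h2 with rfl | ⟨i, ⟨rfl, rfl⟩ | ⟨rfl, rfl⟩⟩
  · exact hxy rfl
  · have h3 := h (hexLeaf i) (by simp)
    rw [dist_self] at h3
    exact hxy (connected.dist_eq_zero_iff.1 h3.symm).symm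
  · have h3 := h (hexLeaf i) (by simp)
    rw [dist_self] at h3
    exact hxy (connected.dist_eq_zero_iff.1 h3)

set_option maxHeartbeats 2000000 in
theorem eq_or_tri_of_edgeDist_eq {x y x' y' : Vert m k d} (hxy : Arc x y) (hxy' : Arc x' y')
    (h1 : min (toLeft x) (toLeft y) = min (toLeft x') (toLeft y'))
    (h2 : min (toRight x) (toRight y) = min (toRight x') (toRight y')) :
    (x = x' ∧ y = y') ∨
      ∃ i, y = y' ∧ ((x = triTop i ∧ x' = triLeaf i) ∨ (x = triLeaf i ∧ x' = triTop i)) := by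
  rcases hxy with ⟨⟨i, hi⟩, ⟨j, hj⟩, h⟩ | ⟨_ | _, ⟨j, hj⟩, h⟩ | ⟨_ | _, ⟨j, hj⟩, h⟩ |
      ⟨⟨i, hi⟩, ⟨j, hj⟩, h⟩ | ⟨⟨i, hi⟩, ⟨j, hj⟩, h⟩ | ⟨⟨i, hi⟩, ⟨j, hj⟩, h⟩ | ⟨i, hi⟩ | ⟨i, hi⟩ |
      ⟨⟨i, hi⟩, ⟨j, hj⟩, h⟩ | ⟨⟨i, hi⟩, ⟨j, hj⟩, h⟩ | ⟨⟨i, hi⟩, ⟨j, hj⟩, h⟩ <;>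
    rcases hxy' with ⟨⟨i', hi'⟩, ⟨j', hj'⟩, h'⟩ | ⟨_ | _, ⟨j', hj'⟩, h'⟩ |
      ⟨_ | _, ⟨j', hj'⟩, h'⟩ | ⟨⟨i', hi'⟩, ⟨j', hj'⟩, h'⟩ | ⟨⟨i', hi'⟩, ⟨j', hj'⟩, h'⟩ |
      ⟨⟨i', hi'⟩, ⟨j', hj'⟩, h'⟩ | ⟨i', hi'⟩ | ⟨i', hi'⟩ | ⟨⟨i', hi'⟩, ⟨j', hj'⟩, h'⟩ |
      ⟨⟨i', hi'⟩, ⟨j', hj'⟩, h'⟩ | ⟨⟨i', hi'⟩, ⟨j', hj'⟩, h'⟩ <;>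
    simp only [toLeft, toRight] at h1 h2 <;>
    (try simp only at h) <;>
    (try simp only at h') <;>
    first
    | omega
    | (obtain rfl : i = i' := by omega
       first
       | simp; done
       | (obtain rfl : j = j' := by omega
          simp))
    | (obtain rfl : j = j' := by omega
       simp)

theorem exists_arc {e : Sym2 (Vert m k d)} (he : e ∈ (graph m k d).edgeSet) :
    ∃ x y, Arc x y ∧ e = s(x, y) := by
  induction e using Sym2.ind with
  | _ x y =>
    rcases he with h | h
    · exact ⟨x, y, h, rfl⟩
    · exact ⟨y, x, h, Sym2.eq_swap⟩

theorem edgeDist_triLeaf_ne {i : Fin k} {y : Vert m k d} (hy : Arc (triTop i) y) :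
    edgeDist (graph m k d) s(triLeaf i, y) (triLeaf i) ≠
      edgeDist (graph m k d) s(triTop i, y) (triLeaf i) := by
  rw [edgeDist_mk, edgeDist_mk, dist_self, Nat.zero_min]
  have h1 : 0 < (graph m k d).dist (triTop i) (triLeaf i) :=
    connected.pos_dist_of_ne (by simp)
  have h2 : 0 < (graph m k d).dist y (triLeaf i) :=
    connected.pos_dist_of_ne (by rintro rfl; cases hy)
  omega

theorem isEdgeMetricGenerator :
    IsEdgeMetricGenerator (graph m k d)
      (insert (left true) (insert (right true) (Set.range triLeaf))) := by
  intro e he f hf hef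
  by_contra! h
  obtain ⟨x, y, hxy, rfl⟩ := exists_arc he
  obtain ⟨x', y', hxy', rfl⟩ := exists_arc hf
  have h1 := h (left true) (by simp)
  have h2 := h (right true) (by simp)
  simp only [edgeDist_mk, dist_left] at h1
  simp only [edgeDist_mk, dist_right] at h2
  rcases eq_or_tri_of_edgeDist_eq hxy hxy' h1 h2 with
    ⟨rfl, rfl⟩ | ⟨i, rfl, ⟨rfl, rfl⟩ | ⟨rfl, rfl⟩⟩
  · exact hef rfl
  · exact edgeDist_triLeaf_ne hxy (h (triLeaf i) (by simp)).symm
  · exact edgeDist_triLeaf_ne hxy' (h (triLeaf i) (by simp))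

theorem dist_eq_succ_of_forall_adj {x y z : Vert m k d} (hxz : x ≠ z)
    (h : ∀ w, (graph m k d).Adj x w → w = y) :
    (graph m k d).dist x z = (graph m k d).dist y z + 1 := by
  obtain ⟨w, hw, hd⟩ := exists_adj_dist_succ connected hxz
  rwa [h w hw] at hd

theorem dist_leftLeaf {b : Bool} {z : Vert m k d} (hz : z ≠ left b) :
    (graph m k d).dist (left b) z = (graph m k d).dist (spine ⟨0, by omega⟩) z + 1 := by
  apply dist_eq_succ_of_forall_adj hz.symm
  rintro w (h | h) <;> cases h
  rename_i h
  exact congrArg spine (Fin.ext h)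

theorem dist_rightLeaf {b : Bool} {z : Vert m k d} (hz : z ≠ right b) :
    (graph m k d).dist (right b) z =
      (graph m k d).dist (spine ⟨3 * m + 2 * k + 1 + d, by omega⟩) z + 1 := by
  apply dist_eq_succ_of_forall_adj hz.symm
  rintro w (h | h) <;> cases h
  rename_i h
  exact congrArg spine (Fin.ext h)

theorem dist_triLeaf {i : Fin k} {z : Vert m k d} (hz : z ≠ triLeaf i) :
    (graph m k d).dist (triLeaf i) z =
      (graph m k d).dist (spine ⟨3 * m + 2 * i + 1, by omega⟩) z + 1 := by
  apply dist_eq_succ_of_forall_adj hz.symm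
  rintro w (h | h) <;> cases h
  rename_i h
  exact congrArg spine (Fin.ext h)

theorem dist_spine_le_triTop {i : Fin k} {z : Vert m k d} (hz : z ≠ triTop i) :
    (graph m k d).dist (spine ⟨3 * m + 2 * i + 1, by omega⟩) z ≤
      (graph m k d).dist (triTop i) z := by
  obtain ⟨w, hw | hw, h⟩ := exists_adj_dist_succ connected hz.symm <;> cases hw
  case triLeft j hj =>
    rw [show j = ⟨3 * m + 2 * i + 1, by omega⟩ from Fin.ext hj] at h
    omega
  case triRight j hj =>
    have := dist_le_dist_add_one connected (x := spine ⟨3 * m + 2 * i + 1, by omega⟩)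
      (y := spine j) (Or.inl (.spine _ _ (by simp only; omega))) z
    omega

theorem dist_hexLeaf_eq_dist_hexTop {i : Fin m} {z : Vert m k d} (h1 : z ≠ hexLeaf i)
    (h2 : z ≠ hexTop i) (h3 : z ≠ hexLeft i) (h4 : z ≠ hexRight i)
    (h5 : z ≠ spine ⟨3 * i + 2, by omega⟩) :
    (graph m k d).dist (hexLeaf i) z = (graph m k d).dist (hexTop i) z := by
  have hc : (graph m k d).Connected := connected
  have hleaf : (graph m k d).dist (hexLeaf i) z =
      (graph m k d).dist (spine ⟨3 * i + 2, by omega⟩) z + 1 := by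
    apply dist_eq_succ_of_forall_adj h1.symm
    rintro w (h | h) <;> cases h
    rename_i h
    exact congrArg spine (Fin.ext h)
  have hmid : (graph m k d).dist (spine ⟨3 * i + 2, by omega⟩) z =
        (graph m k d).dist (spine ⟨3 * i + 1, by omega⟩) z + 1 ∨
      (graph m k d).dist (spine ⟨3 * i + 2, by omega⟩) z =
        (graph m k d).dist (spine ⟨3 * i + 3, by omega⟩) z + 1 := by
    obtain ⟨w, hw | hw, h⟩ := exists_adj_dist_succ hc h5.symm <;> cases hw
    case spine j hj =>
      rw [show j = ⟨3 * i + 3, by omega⟩ from Fin.ext hj] at h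
      exact Or.inr h
    case spine j hj =>
      rw [show j = ⟨3 * i + 1, by omega⟩ from Fin.ext (by simp only at hj ⊢; omega)] at h
      exact Or.inl h
    case hexLeaf j hj =>
      obtain rfl : j = i := Fin.ext (by simp only at hj; omega)
      omega
    all_goals rename_i hj; simp only at hj; omega
  have htop : (graph m k d).dist (hexTop i) z = (graph m k d).dist (hexLeft i) z + 1 ∨
      (graph m k d).dist (hexTop i) z = (graph m k d).dist (hexRight i) z + 1 := by
    obtain ⟨w, hw | hw, h⟩ := exists_adj_dist_succ hc h2.symm <;> cases hw
    · exact Or.inl h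
    · exact Or.inr h
  have hl : (graph m k d).dist (hexLeft i) z =
        (graph m k d).dist (spine ⟨3 * i + 1, by omega⟩) z + 1 ∨
      (graph m k d).dist (hexLeft i) z = (graph m k d).dist (hexTop i) z + 1 := by
    obtain ⟨w, hw | hw, h⟩ := exists_adj_dist_succ hc h3.symm <;> cases hw
    case hexLeft j hj =>
      rw [show j = ⟨3 * i + 1, by omega⟩ from Fin.ext hj] at h
      exact Or.inl h
    · exact Or.inr h
  have hr : (graph m k d).dist (hexRight i) z =
        (graph m k d).dist (spine ⟨3 * i + 3, by omega⟩) z + 1 ∨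
      (graph m k d).dist (hexRight i) z = (graph m k d).dist (hexTop i) z + 1 := by
    obtain ⟨w, hw | hw, h⟩ := exists_adj_dist_succ hc h4.symm <;> cases hw
    case hexRight j hj =>
      rw [show j = ⟨3 * i + 3, by omega⟩ from Fin.ext hj] at h
      exact Or.inl h
    · exact Or.inr h
  have a1 := dist_le_dist_add_one hc (Arc.hexTopLeft (k := k) (d := d) i).adj z
  have a2 := dist_le_dist_add_one hc (Arc.hexTopRight (k := k) (d := d) i).adj z
  have a3 := dist_le_dist_add_one hc
    (Arc.hexLeft (k := k) (d := d) i ⟨3 * i + 1, by omega⟩ rfl).adj z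
  have a4 := dist_le_dist_add_one hc
    (Arc.hexRight (k := k) (d := d) i ⟨3 * i + 3, by omega⟩ rfl).adj z
  have a5 := dist_le_dist_add_one hc (Arc.spine (k := k) (d := d) (m := m)
    ⟨3 * i + 2, by omega⟩ ⟨3 * i + 3, by omega⟩ rfl).adj z
  have a6 := dist_le_dist_add_one hc (Arc.spine (k := k) (d := d) (m := m)
    ⟨3 * i + 1, by omega⟩ ⟨3 * i + 2, by omega⟩ rfl).adj.symm z
  omega

/-- Labels the vertices by the part of the graph that a metric generator has to meet. -/
def vertexClass : Vert m k d → ℕ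
  | spine j => (j + 4) / 3
  | left _ => 0
  | right _ => 1
  | hexLeaf i | hexTop i | hexLeft i | hexRight i => i + 2
  | triTop _ | triLeaf _ => 0

/-- Labels the vertices by the part of the graph that an edge metric generator has to meet. -/
def edgeClass : Vert m k d → ℕ
  | left _ => 0
  | right _ => 1
  | triTop i | triLeaf i => i + 2
  | _ => 0

theorem le_ncard_of_isMetricGenerator {S : Set (Vert m k d)} (hS : S.Finite)
    (h : IsMetricGenerator (graph m k d) S) : m + 2 ≤ S.ncard := by
  apply le_ncard_of_hits hS vertexClass
  rintro (_ | _ | i) hi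
  · obtain ⟨z, hz, hne⟩ := h (left true) (left false) (by simp)
    refine ⟨z, hz, ?_⟩
    by_contra hcl
    exact hne ((dist_leftLeaf (by rintro rfl; exact hcl rfl)).trans
      (dist_leftLeaf (by rintro rfl; exact hcl rfl)).symm)
  · obtain ⟨z, hz, hne⟩ := h (right true) (right false) (by simp)
    refine ⟨z, hz, ?_⟩
    by_contra hcl
    exact hne ((dist_rightLeaf (by rintro rfl; exact hcl rfl)).trans
      (dist_rightLeaf (by rintro rfl; exact hcl rfl)).symm)
  · obtain ⟨z, hz, hne⟩ := h (hexLeaf ⟨i, by omega⟩) (hexTop ⟨i, by omega⟩) (by simp)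
    refine ⟨z, hz, ?_⟩
    by_contra hcl
    refine hne (dist_hexLeaf_eq_dist_hexTop ?_ ?_ ?_ ?_ ?_) <;> rintro rfl <;> apply hcl
    all_goals simp only [vertexClass]
    omega

theorem le_ncard_of_isEdgeMetricGenerator {S : Set (Vert m k d)} (hS : S.Finite)
    (h : IsEdgeMetricGenerator (graph m k d) S) : k + 2 ≤ S.ncard := by
  apply le_ncard_of_hits hS edgeClass
  rintro (_ | _ | i) hi
  · obtain ⟨z, hz, hne⟩ := h s(left true, spine ⟨0, by omega⟩) (Arc.left _ _ rfl).adj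
      s(left false, spine ⟨0, by omega⟩) (Arc.left _ _ rfl).adj (by simp)
    refine ⟨z, hz, ?_⟩
    by_contra hcl
    rw [edgeDist_mk, edgeDist_mk, dist_leftLeaf (by rintro rfl; exact hcl rfl),
      dist_leftLeaf (by rintro rfl; exact hcl rfl)] at hne
    exact hne rfl
  · obtain ⟨z, hz, hne⟩ := h s(right true, spine ⟨3 * m + 2 * k + 1 + d, by omega⟩)
      (Arc.right _ _ rfl).adj s(right false, spine ⟨3 * m + 2 * k + 1 + d, by omega⟩)
      (Arc.right _ _ rfl).adj (by simp)
    refine ⟨z, hz, ?_⟩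
    by_contra hcl
    rw [edgeDist_mk, edgeDist_mk, dist_rightLeaf (by rintro rfl; exact hcl rfl),
      dist_rightLeaf (by rintro rfl; exact hcl rfl)] at hne
    exact hne rfl
  · obtain ⟨z, hz, hne⟩ := h s(triTop ⟨i, by omega⟩, spine ⟨3 * m + 2 * i + 1, by omega⟩)
      (Arc.triLeft _ _ rfl).adj s(triLeaf ⟨i, by omega⟩, spine ⟨3 * m + 2 * i + 1, by omega⟩)
      (Arc.triLeaf _ _ rfl).adj (by simp)
    refine ⟨z, hz, ?_⟩
    by_contra hcl
    have h1 := dist_triLeaf (i := ⟨i, by omega⟩) (z := z) (by rintro rfl; exact hcl rfl)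
    have h2 := dist_spine_le_triTop (i := ⟨i, by omega⟩) (z := z) fun hzi => hcl (by rw [hzi]; rfl)
    rw [edgeDist_mk, edgeDist_mk] at hne
    simp only at h1 h2
    omega

theorem metricDim_graph : metricDim (graph m k d) = m + 2 :=
  sInf_ncard_eq (Set.toFinite _) isMetricGenerator (ncard_pair_union_range_le _ _ _)
    fun _ => le_ncard_of_isMetricGenerator

theorem edgeMetricDim_graph : edgeMetricDim (graph m k d) = k + 2 :=
  sInf_ncard_eq (Set.toFinite _) isEdgeMetricGenerator (ncard_pair_union_range_le _ _ _)
    fun _ => le_ncard_of_isEdgeMetricGenerator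

end Vert

end RealizationDimEdim

/-- For all integers `k1, k2 ≥ 2` with `k1 ≠ k2`, there is `n0` such that for
every `n ≥ n0` there exists a connected graph on `n` vertices with metric
dimension `k1` and edge metric dimension `k2`. -/
theorem realization_dim_edim (k1 k2 : ℕ) (hk1 : 2 ≤ k1) (hk2 : 2 ≤ k2) (hne : k1 ≠ k2) :
    ∃ n0 : ℕ, ∀ n : ℕ, n0 ≤ n →
      ∃ (V : Type) (inst : Fintype V) (G : SimpleGraph V),
        G.Connected ∧ @Fintype.card V inst = n ∧
        metricDim G = k1 ∧ edgeMetricDim G = k2 := by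
  obtain ⟨m, rfl⟩ := Nat.exists_eq_add_of_le' hk1
  obtain ⟨k, rfl⟩ := Nat.exists_eq_add_of_le' hk2
  refine ⟨7 * m + 4 * k + 6, fun n hn => ?_⟩
  obtain ⟨d, rfl⟩ := Nat.exists_eq_add_of_le hn
  exact ⟨RealizationDimEdim.Vert m k d, inferInstance, RealizationDimEdim.Vert.graph m k d,
    RealizationDimEdim.Vert.connected, RealizationDimEdim.Vert.card_eq,
    RealizationDimEdim.Vert.metricDim_graph, RealizationDimEdim.Vert.edgeMetricDim_graph⟩
end

section
/- Let n1 ≥ 5 be odd, n2 ≥ 1 and n3 ≥ 2. Then the edge metric dimension of G_{n1,n2,n3} equals n3 + 1. -/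
/-- Vertices of the graph `G_{n1,n2,n3}`: cycle vertices `a 0, …, a (n1-1)`
(with `a k` standing for the paper's `a_{k+1}`), path vertices
`b 0, …, b (n2-1)`, the special vertices `c` and `i`, and pendant vertices
`j 0, …, j (n3-1)` attached to `i`. -/
inductive GVert (n1 n2 n3 : ℕ) : Type where
  | a : Fin n1 → GVert n1 n2 n3
  | b : Fin n2 → GVert n1 n2 n3
  | c : GVert n1 n2 n3
  | i : GVert n1 n2 n3
  | j : Fin n3 → GVert n1 n2 n3

/-- Base relation whose symmetrization gives the edges of `G_{n1,n2,n3}`: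
the cycle `a_1 a_2 ⋯ a_{n1} a_1`, the path `b_1 b_2 ⋯ b_{n2}` joined by the
edge `a_2 b_1`, the edge `a_{n1} c`, the edge `a_1 i`, and the pendant edges
`i j_t`. -/
def GRel (n1 n2 n3 : ℕ) : GVert n1 n2 n3 → GVert n1 n2 n3 → Prop
  | .a k, .a l => (l : ℕ) = ((k : ℕ) + 1) % n1
  | .a k, .b m => (k : ℕ) = 1 ∧ (m : ℕ) = 0
  | .b m, .b m' => (m' : ℕ) = (m : ℕ) + 1
  | .a k, .c => (k : ℕ) = n1 - 1
  | .a k, .i => (k : ℕ) = 0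
  | .i, .j _ => True
  | _, _ => False

/-- The graph `G_{n1,n2,n3}` from the paper. -/
def GGraph (n1 n2 n3 : ℕ) : SimpleGraph (GVert n1 n2 n3) :=
  SimpleGraph.fromRel (GRel n1 n2 n3)

/-- A function that vanishes only at `v`, is 1-Lipschitz along edges and admits a descending
neighbour away from `v` is the distance to `v`. -/
theorem SimpleGraph.dist_eq_of_lipschitz_of_descent {V : Type*} (G : SimpleGraph V) (v : V)
    (f : V → ℕ) (h0 : f v = 0) (hlip : ∀ u w, G.Adj u w → f u ≤ f w + 1)
    (hdesc : ∀ u, u ≠ v → ∃ w, G.Adj u w ∧ f w + 1 = f u) (u : V) : G.dist u v = f u := by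
  have hle : ∀ (u w : V) (p : G.Walk u w), f u ≤ f w + p.length := by
    intro u w p
    induction p with
    | nil => simp
    | cons h p ih =>
      have := hlip _ _ h
      rw [SimpleGraph.Walk.length_cons]
      omega
  have hwalk : ∀ (n : ℕ) (u : V), f u = n → ∃ p : G.Walk u v, p.length = n := by
    intro n
    induction n with
    | zero =>
      intro u hu
      by_cases huv : u = v
      · subst huv
        exact ⟨.nil, rfl⟩
      · obtain ⟨w, -, hw⟩ := hdesc u huv
        omega
    | succ n ih =>
      intro u hu
      have huv : u ≠ v := by
        rintro rfl
        omega
      obtain ⟨w, hadj, hw⟩ := hdesc u huv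
      obtain ⟨p, hp⟩ := ih w (by omega)
      exact ⟨.cons hadj p, by simp [hp]⟩
  obtain ⟨p, hp⟩ := hwalk _ u rfl
  apply le_antisymm
  · exact hp ▸ SimpleGraph.dist_le p
  · obtain ⟨q, hq⟩ := (SimpleGraph.Walk.reachable p).exists_walk_length_eq_dist
    have := hle u v q
    omega

/-- Distance between the positions `x` and `y` on a cycle of length `n`. -/
def cycleDist (n x y : ℕ) : ℕ :=
  min ((x - y) + (y - x)) (n - ((x - y) + (y - x)))

/-- Explicit distance function of `GGraph n1 n2 n3`. -/
def gDist {n1 n2 n3 : ℕ} : GVert n1 n2 n3 → GVert n1 n2 n3 → ℕ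
  | .a k, .a l => cycleDist n1 k l
  | .a k, .b m => cycleDist n1 k 1 + m + 1
  | .a k, .c => cycleDist n1 k (n1 - 1) + 1
  | .a k, .i => cycleDist n1 k 0 + 1
  | .a k, .j _ => cycleDist n1 k 0 + 2
  | .b m, .a k => cycleDist n1 k 1 + m + 1
  | .b m, .b m' => (m - m' : ℕ) + (m' - m : ℕ)
  | .b m, .c => m + 4
  | .b m, .i => m + 3
  | .b m, .j _ => m + 4
  | .c, .a k => cycleDist n1 k (n1 - 1) + 1
  | .c, .b m => m + 4
  | .c, .c => 0
  | .c, .i => 3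
  | .c, .j _ => 4
  | .i, .a k => cycleDist n1 k 0 + 1
  | .i, .b m => m + 3
  | .i, .c => 3
  | .i, .i => 0
  | .i, .j _ => 1
  | .j _, .a k => cycleDist n1 k 0 + 2
  | .j _, .b m => m + 4
  | .j _, .c => 4
  | .j _, .i => 1
  | .j s, .j t => if s = t then 0 else 2

namespace GGraph

variable {n1 n2 n3 : ℕ}

theorem cycleDist_zero_right (n x : ℕ) : cycleDist n x 0 = min x (n - x) := by
  simp [cycleDist]

theorem cycleDist_one_right {n x : ℕ} (hn : 2 ≤ n) (hx : x < n) :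
    cycleDist n x 1 = min (x - 1 + (1 - x)) (n + 1 - x) := by
  simp only [cycleDist]
  omega

theorem cycleDist_pred_right {n x : ℕ} (hx : x < n) :
    cycleDist n x (n - 1) = min (n - 1 - x) (x + 1) := by
  simp only [cycleDist]
  omega

theorem adj_of_rel {u v : GVert n1 n2 n3} (hne : u ≠ v) (h : GRel n1 n2 n3 u v) :
    (GGraph n1 n2 n3).Adj u v :=
  (SimpleGraph.fromRel_adj _ _ _).2 ⟨hne, .inl h⟩

theorem adj_a_succ {x : ℕ} (h : x + 1 < n1) :
    (GGraph n1 n2 n3).Adj (.a ⟨x, by omega⟩) (.a ⟨x + 1, h⟩) :=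
  adj_of_rel (by simp) (by simp [GRel, Nat.mod_eq_of_lt h])

theorem adj_a_last (h : 2 ≤ n1) :
    (GGraph n1 n2 n3).Adj (.a ⟨n1 - 1, by omega⟩) (.a ⟨0, by omega⟩) :=
  adj_of_rel (by simp; omega) (by simp [GRel, Nat.sub_add_cancel (by omega : 1 ≤ n1)])

theorem adj_a_b (h : 2 ≤ n1) (h2 : 1 ≤ n2) :
    (GGraph n1 n2 n3).Adj (.a ⟨1, by omega⟩) (.b ⟨0, by omega⟩) :=
  adj_of_rel (by simp) (by simp [GRel])

theorem adj_b_succ {m : ℕ} (h : m + 1 < n2) :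
    (GGraph n1 n2 n3).Adj (.b ⟨m, by omega⟩) (.b ⟨m + 1, h⟩) :=
  adj_of_rel (by simp) (by simp [GRel])

theorem adj_a_c (h : 1 ≤ n1) : (GGraph n1 n2 n3).Adj (.a ⟨n1 - 1, by omega⟩) .c :=
  adj_of_rel (by simp) (by simp [GRel])

theorem adj_a_i (h : 1 ≤ n1) : (GGraph n1 n2 n3).Adj (.a ⟨0, by omega⟩) .i :=
  adj_of_rel (by simp) (by simp [GRel])

theorem adj_i_j (t : Fin n3) : (GGraph n1 n2 n3).Adj .i (.j t) :=
  adj_of_rel (by simp) (by simp [GRel])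

theorem edge_cases (h1 : 5 ≤ n1) (h2 : 1 ≤ n2) {e : Sym2 (GVert n1 n2 n3)}
    (he : e ∈ (GGraph n1 n2 n3).edgeSet) :
    (∃ x, ∃ hx : x + 1 < n1, e = s(.a ⟨x, by omega⟩, .a ⟨x + 1, hx⟩)) ∨
    e = s(.a ⟨n1 - 1, by omega⟩, .a ⟨0, by omega⟩) ∨
    e = s(.a ⟨1, by omega⟩, .b ⟨0, by omega⟩) ∨
    (∃ m, ∃ hm : m + 1 < n2, e = s(.b ⟨m, by omega⟩, .b ⟨m + 1, hm⟩)) ∨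
    e = s(.a ⟨n1 - 1, by omega⟩, .c) ∨
    e = s(.a ⟨0, by omega⟩, .i) ∨
    ∃ t, e = s(.i, .j t) := by
  obtain ⟨u, v, h, rfl⟩ : ∃ u v, GRel n1 n2 n3 u v ∧ e = s(u, v) := by
    induction e with
    | _ u v =>
      rw [SimpleGraph.mem_edgeSet, GGraph, SimpleGraph.fromRel_adj] at he
      obtain ⟨-, h | h⟩ := he
      · exact ⟨u, v, h, rfl⟩
      · exact ⟨v, u, h, Sym2.eq_swap⟩
  rcases u with ⟨x, hx⟩ | ⟨m, hm⟩ | _ | _ | s <;>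
    rcases v with ⟨y, hy⟩ | ⟨m', hm'⟩ | _ | _ | t <;> simp only [GRel] at h
  · by_cases hl : x + 1 < n1
    · rw [Nat.mod_eq_of_lt hl] at h
      subst h
      exact .inl ⟨x, hl, rfl⟩
    · obtain rfl : x = n1 - 1 := by omega
      rw [Nat.sub_add_cancel (by omega), Nat.mod_self] at h
      subst h
      exact .inr (.inl rfl)
  · obtain ⟨rfl, rfl⟩ := h
    exact .inr (.inr (.inl rfl))
  · subst h
    exact .inr (.inr (.inr (.inr (.inl rfl))))
  · subst h
    exact .inr (.inr (.inr (.inr (.inr (.inl rfl)))))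
  · subst h
    exact .inr (.inr (.inr (.inl ⟨m, hm', rfl⟩)))
  · exact .inr (.inr (.inr (.inr (.inr (.inr ⟨t, rfl⟩)))))

theorem gDist_lipschitz (h1 : 5 ≤ n1) (h2 : 1 ≤ n2) (v u w : GVert n1 n2 n3)
    (h : (GGraph n1 n2 n3).Adj u w) : gDist u v ≤ gDist w v + 1 := by
  rcases edge_cases h1 h2 ((SimpleGraph.mem_edgeSet _).2 h) with
    ⟨x, hx, heq⟩ | heq | heq | ⟨m, hm, heq⟩ | heq | heq | ⟨t, heq⟩ <;>
  obtain ⟨rfl, rfl⟩ | ⟨rfl, rfl⟩ := Sym2.eq_iff.1 heq <;>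
  rcases v with ⟨y, hy⟩ | ⟨y, hy⟩ | _ | _ | s <;> simp only [gDist, cycleDist] <;>
  (try split_ifs) <;> omega

theorem exists_adj_cycleDist (h1 : 5 ≤ n1) {x p : ℕ} (hx : x < n1) (hp : p < n1) (hne : x ≠ p) :
    ∃ y, ∃ hy : y < n1, (GGraph n1 n2 n3).Adj (.a ⟨x, hx⟩) (.a ⟨y, hy⟩) ∧
      cycleDist n1 y p + 1 = cycleDist n1 x p := by
  have up : ∀ y (hy : y < n1), y = x + 1 ∨ (x = n1 - 1 ∧ y = 0) →
      (GGraph n1 n2 n3).Adj (.a ⟨x, hx⟩) (.a ⟨y, hy⟩) := by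
    rintro y hy (rfl | ⟨rfl, rfl⟩)
    · exact adj_a_succ hy
    · exact adj_a_last (by omega)
  have down : ∀ y (hy : y < n1), x = y + 1 ∨ (y = n1 - 1 ∧ x = 0) →
      (GGraph n1 n2 n3).Adj (.a ⟨x, hx⟩) (.a ⟨y, hy⟩) := by
    rintro y hy (rfl | ⟨rfl, rfl⟩)
    · exact (adj_a_succ hx).symm
    · exact (adj_a_last (by omega)).symm
  by_cases hdir : (x < p ∧ p - x ≤ n1 - (p - x)) ∨ (p < x ∧ n1 - (x - p) ≤ x - p)
  · by_cases hl : x + 1 < n1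
    · exact ⟨x + 1, hl, up _ _ (by omega), by simp only [cycleDist]; omega⟩
    · exact ⟨0, by omega, up _ _ (by omega), by simp only [cycleDist]; omega⟩
  · by_cases hl : x = 0
    · exact ⟨n1 - 1, by omega, down _ _ (by omega), by simp only [cycleDist]; omega⟩
    · exact ⟨x - 1, by omega, down _ _ (by omega), by simp only [cycleDist]; omega⟩

theorem exists_adj_gDist (h1 : 5 ≤ n1) (h2 : 1 ≤ n2) (v u : GVert n1 n2 n3) (hne : u ≠ v) :
    ∃ w, (GGraph n1 n2 n3).Adj u w ∧ gDist w v + 1 = gDist u v := by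
  rcases u with ⟨x, hx⟩ | ⟨m, hm⟩ | _ | _ | s
  · have along : ∀ p < n1, x ≠ p → (∃ r, ∀ y (hy : y < n1),
        gDist (.a ⟨y, hy⟩) v = cycleDist n1 y p + r) →
        ∃ w, (GGraph n1 n2 n3).Adj (.a ⟨x, hx⟩) w ∧ gDist w v + 1 = gDist (.a ⟨x, hx⟩) v := by
      rintro p hp hxp ⟨r, hr⟩
      obtain ⟨y, hy, hadj, hd⟩ := exists_adj_cycleDist h1 hx hp hxp
      exact ⟨_, hadj, by rw [hr, hr]; omega⟩
    rcases v with ⟨y, hy⟩ | ⟨m', hm'⟩ | _ | _ | t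
    · exact along y hy (by simpa using hne) ⟨0, fun _ _ => rfl⟩
    · by_cases hp : x = 1
      · subst hp
        exact ⟨_, adj_a_b (by omega) h2, by simp only [gDist, cycleDist]; omega⟩
      · exact along 1 (by omega) hp ⟨m' + 1, fun _ _ => by simp only [gDist]; omega⟩
    · by_cases hp : x = n1 - 1
      · subst hp
        exact ⟨_, adj_a_c (by omega), by simp only [gDist, cycleDist]; omega⟩
      · exact along (n1 - 1) (by omega) hp ⟨1, fun _ _ => rfl⟩
    · by_cases hp : x = 0
      · subst hp
        exact ⟨_, adj_a_i (by omega), by simp only [gDist, cycleDist]; omega⟩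
      · exact along 0 (by omega) hp ⟨1, fun _ _ => rfl⟩
    · by_cases hp : x = 0
      · subst hp
        exact ⟨_, adj_a_i (by omega), by simp only [gDist, cycleDist]; omega⟩
      · exact along 0 (by omega) hp ⟨2, fun _ _ => rfl⟩
  · by_cases hup : ∃ m' : Fin n2, v = .b m' ∧ m < m'
    · obtain ⟨⟨m', hm'⟩, rfl, hlt⟩ := hup
      simp only at hlt
      exact ⟨_, adj_b_succ (by omega : m + 1 < n2), by simp only [gDist]; omega⟩
    · have hup' : ∀ m' : Fin n2, v = .b m' → (m' : ℕ) < m := by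
        rintro ⟨m', hm'⟩ rfl
        have : m ≠ m' := by simpa using hne
        have : ¬ m < m' := fun h => hup ⟨_, rfl, h⟩
        simp only
        omega
      rcases m with _ | m
      · refine ⟨_, (adj_a_b (by omega) h2).symm, ?_⟩
        rcases v with ⟨y, hy⟩ | m' | _ | _ | t
        · simp only [gDist, cycleDist]; omega
        · exact absurd (hup' m' rfl) (by omega)
        all_goals simp only [gDist, cycleDist]; omega
      · refine ⟨_, (adj_b_succ hm).symm, ?_⟩
        rcases v with ⟨y, hy⟩ | m' | _ | _ | t
        · simp only [gDist, cycleDist]; omega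
        · have := hup' m' rfl
          simp only [gDist]; omega
        all_goals simp only [gDist]
  · refine ⟨_, (adj_a_c (by omega)).symm, ?_⟩
    rcases v with ⟨y, hy⟩ | m' | _ | _ | t
    · simp only [gDist, cycleDist]; omega
    · simp only [gDist, cycleDist]; omega
    · exact absurd rfl hne
    all_goals simp only [gDist, cycleDist]; omega
  · by_cases hj : ∃ t, v = .j t
    · obtain ⟨t, rfl⟩ := hj
      exact ⟨_, adj_i_j t, by simp [gDist]⟩
    · refine ⟨_, (adj_a_i (by omega)).symm, ?_⟩
      rcases v with ⟨y, hy⟩ | m' | _ | _ | t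
      · simp only [gDist, cycleDist]; omega
      · simp only [gDist, cycleDist]; omega
      · simp only [gDist, cycleDist]; omega
      · exact absurd rfl hne
      · exact absurd ⟨t, rfl⟩ hj
  · refine ⟨_, (adj_i_j s).symm, ?_⟩
    rcases v with ⟨y, hy⟩ | m' | _ | _ | t
    · simp only [gDist, cycleDist]
    · simp only [gDist]
    · simp only [gDist]
    · simp only [gDist]
    · have : s ≠ t := by simpa using hne
      simp [gDist, this]

theorem gDist_self (v : GVert n1 n2 n3) : gDist v v = 0 := by
  cases v <;> simp [gDist, cycleDist]

theorem dist_eq_gDist (h1 : 5 ≤ n1) (h2 : 1 ≤ n2) (u v : GVert n1 n2 n3) :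
    (GGraph n1 n2 n3).dist u v = gDist u v :=
  SimpleGraph.dist_eq_of_lipschitz_of_descent _ v (gDist · v) (gDist_self v)
    (gDist_lipschitz h1 h2 v) (exists_adj_gDist h1 h2 v) u

theorem edgeDist_mk (h1 : 5 ≤ n1) (h2 : 1 ≤ n2) (u v z : GVert n1 n2 n3) :
    edgeDist (GGraph n1 n2 n3) s(u, v) z = min (gDist u z) (gDist v z) := by
  simp only [edgeDist, Sym2.lift_mk, dist_eq_gDist h1 h2]

theorem j_mem_or_j_mem (h1 : 5 ≤ n1) (h2 : 1 ≤ n2) {S : Set (GVert n1 n2 n3)}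
    (hS : IsEdgeMetricGenerator (GGraph n1 n2 n3) S) {s t : Fin n3} (hst : s ≠ t) :
    .j s ∈ S ∨ .j t ∈ S := by
  obtain ⟨z, hz, hd⟩ := hS s(.i, .j s) (adj_i_j s) s(.i, .j t) (adj_i_j t) (by simp [hst])
  rw [edgeDist_mk h1 h2, edgeDist_mk h1 h2] at hd
  rcases z with ⟨y, hy⟩ | m' | _ | _ | r
  · simp [gDist] at hd
  · simp [gDist] at hd
  · simp [gDist] at hd
  · simp [gDist] at hd
  · by_cases hs : s = r
    · exact .inl (hs ▸ hz)
    · by_cases ht : t = r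
      · exact .inr (ht ▸ hz)
      · simp [gDist, hs, ht] at hd

theorem not_subsingleton_diff_range_j (h1 : 5 ≤ n1) (hodd : Odd n1) (h2 : 1 ≤ n2)
    {S : Set (GVert n1 n2 n3)} (hS : IsEdgeMetricGenerator (GGraph n1 n2 n3) S) :
    ¬ (S \ Set.range .j).Subsingleton := by
  intro hsub
  have hab := (SimpleGraph.mem_edgeSet _).2
    (adj_a_b (n1 := n1) (n2 := n2) (n3 := n3) (by omega) h2)
  have hac := (SimpleGraph.mem_edgeSet _).2
    (adj_a_c (n1 := n1) (n2 := n2) (n3 := n3) (by omega))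
  have hr := (SimpleGraph.mem_edgeSet _).2
    (adj_a_succ (n1 := n1) (n2 := n2) (n3 := n3) (x := 1) (by omega))
  have hl := (SimpleGraph.mem_edgeSet _).2
    (adj_a_succ (n1 := n1) (n2 := n2) (n3 := n3) (x := n1 - 2) (by omega))
  have outside : ∀ e f, (∀ t, edgeDist (GGraph n1 n2 n3) e (.j t) = edgeDist (GGraph n1 n2 n3) f (.j t)) →
      (∃ z ∈ S, edgeDist (GGraph n1 n2 n3) e z ≠ edgeDist (GGraph n1 n2 n3) f z) →
      ∃ z ∈ S \ Set.range .j, edgeDist (GGraph n1 n2 n3) e z ≠ edgeDist (GGraph n1 n2 n3) f z := by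
    rintro e f hj ⟨z, hz, hd⟩
    refine ⟨z, ⟨hz, ?_⟩, hd⟩
    rintro ⟨t, rfl⟩
    exact hd (hj t)
  obtain ⟨k, hk⟩ := hodd
  obtain ⟨z, hz, hd⟩ := outside _ _
    (by intro t; simp only [edgeDist_mk h1 h2, gDist, cycleDist]; omega)
    (hS _ hab _ hr (by simp))
  obtain ⟨z', hz', hd'⟩ := outside _ _
    (by intro t; simp only [edgeDist_mk h1 h2, gDist, cycleDist]; omega)
    (hS _ hac _ hl (by simp))
  obtain ⟨w, hw, hdw⟩ := outside _ _
    (by intro t; simp only [edgeDist_mk h1 h2, gDist, cycleDist]; omega)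
    (hS _ hab _ hl (by simp))
  obtain ⟨w', hw', hdw'⟩ := outside _ _
    (by intro t; simp only [edgeDist_mk h1 h2, gDist, cycleDist]; omega)
    (hS _ hac _ hr (by simp))
  obtain rfl := hsub hz hz'
  obtain rfl := hsub hz hw
  obtain rfl := hsub hz hw'
  rcases z with ⟨y, hy⟩ | ⟨m, hm⟩ | _ | _ | t
  · simp only [edgeDist_mk h1 h2, gDist, cycleDist] at hd hd' hdw hdw'
    have hle : y ≤ k + 1 := by
      clear hd' hdw hdw'
      by_contra
      omega
    have hge : k ≤ y := by
      clear hd hdw hdw'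
      by_contra
      omega
    clear hd hd'
    obtain rfl | rfl : y = k ∨ y = k + 1 := by omega
    · clear hdw'
      omega
    · clear hdw
      omega
  · simp only [edgeDist_mk h1 h2, gDist, cycleDist] at hd'; omega
  · simp only [edgeDist_mk h1 h2, gDist, cycleDist] at hd; omega
  · simp only [edgeDist_mk h1 h2, gDist, cycleDist] at hd; omega
  · exact hz.2 ⟨t, rfl⟩

theorem j_injective : Function.Injective (GVert.j : Fin n3 → GVert n1 n2 n3) :=
  fun _ _ h => by simpa using h

theorem le_ncard (h1 : 5 ≤ n1) (hodd : Odd n1) (h2 : 1 ≤ n2) {S : Set (GVert n1 n2 n3)}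
    (hfin : S.Finite) (hS : IsEdgeMetricGenerator (GGraph n1 n2 n3) S) : n3 + 1 ≤ S.ncard := by
  set J : Set (GVert n1 n2 n3) := Set.range .j with hJ
  have hJfin : J.Finite := Set.finite_range _
  have hJcard : J.ncard = n3 := by
    rw [hJ, ← Set.image_univ, Set.ncard_image_of_injective _ j_injective, Set.ncard_univ,
      Nat.card_eq_fintype_card, Fintype.card_fin]
  have hmissing : (J \ S).ncard ≤ 1 := by
    rw [Set.ncard_le_one hJfin.sdiff]
    rintro _ ⟨⟨s, rfl⟩, hs⟩ _ ⟨⟨t, rfl⟩, ht⟩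
    by_contra hne
    have hst : s ≠ t := fun h => hne (h ▸ rfl)
    exact (j_mem_or_j_mem h1 h2 hS hst).elim hs ht
  have houtside : 1 < (S \ J).ncard := by
    have : Finite ↑(S \ J) := hfin.sdiff.to_subtype
    rw [Set.one_lt_ncard_iff_nontrivial]
    exact Set.not_subsingleton_iff.1 (not_subsingleton_diff_range_j h1 hodd h2 hS)
  have hcardS := Set.ncard_inter_add_ncard_sdiff_eq_ncard S J hfin
  have hcardJ := Set.ncard_inter_add_ncard_sdiff_eq_ncard J S hJfin
  rw [Set.inter_comm] at hcardJ
  omega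

set_option maxHeartbeats 1000000 in
theorem isEdgeMetricGenerator (h1 : 5 ≤ n1) (hodd : Odd n1) (h2 : 1 ≤ n2) (h3 : 2 ≤ n3) :
    IsEdgeMetricGenerator (GGraph n1 n2 n3)
      (insert (.b ⟨n2 - 1, by omega⟩) (insert .c (.j '' {(⟨0, by omega⟩ : Fin n3)}ᶜ))) := by
  intro e he f hf hne
  by_contra hcon
  push Not at hcon
  apply hne
  have hb := hcon _ (Set.mem_insert _ _)
  have hc := hcon .c (by simp)
  have hj : ∀ t : Fin n3, (t : ℕ) ≠ 0 →
      edgeDist (GGraph n1 n2 n3) e (.j t) = edgeDist (GGraph n1 n2 n3) f (.j t) := by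
    intro t ht
    refine hcon _ (.inr (.inr ⟨t, ?_, rfl⟩))
    rintro rfl
    exact ht rfl
  clear hcon hne
  obtain ⟨k, hk⟩ := hodd
  have hj1 := hj ⟨1, by omega⟩ one_ne_zero
  rcases edge_cases h1 h2 he with
    ⟨x, hx, rfl⟩ | rfl | rfl | ⟨m, hm, rfl⟩ | rfl | rfl | ⟨s, rfl⟩ <;>
  rcases edge_cases h1 h2 hf with
    ⟨y, hy, rfl⟩ | rfl | rfl | ⟨m', hm', rfl⟩ | rfl | rfl | ⟨t, rfl⟩ <;>
  simp only [edgeDist_mk h1 h2, gDist] at hb hc hj hj1 <;>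
  clear he hf <;>
  (try simp (disch := omega) only [cycleDist_zero_right, cycleDist_one_right,
    cycleDist_pred_right] at hb hc hj1)
  · by_cases hne : x = y
    · subst hne
      rfl
    · have hxy : x + y + 1 = n1 := by
        clear hb hc hj
        omega
      clear hc hj hj1
      exfalso
      omega
  all_goals first
    | rfl
    | exfalso; clear hj hb hc; (try split_ifs at hj1) <;> omega
    | exfalso; clear hj hb hj1; omega
    | exfalso; clear hj hc hj1; omega
    | exfalso; clear hj hb; omega
    | skip
  · obtain rfl : m = m' := by
      clear hj hb hc
      omega
    rfl
  · by_cases hst : s = t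
    · rw [hst]
    · exfalso
      by_cases hs : (s : ℕ) = 0
      · have := hj t fun ht => hst (Fin.ext (hs.trans ht.symm))
        simp [hst] at this
      · have := hj s hs
        simp [Ne.symm hst] at this

end GGraph

/-- Lemma 4 (odd case): if `n1` is odd then `edim(G_{n1,n2,n3}) = n3 + 1`. -/
theorem edgeMetricDim_GGraph_odd (n1 n2 n3 : ℕ) (h1 : 5 ≤ n1) (hodd : Odd n1)
    (h2 : 1 ≤ n2) (h3 : 2 ≤ n3) :
    edgeMetricDim (GGraph n1 n2 n3) = n3 + 1 := by
  have hmem : n3 + 1 ∈ {n | ∃ S : Set (GVert n1 n2 n3), S.Finite ∧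
      IsEdgeMetricGenerator (GGraph n1 n2 n3) S ∧ S.ncard = n} := by
    have hJfin : (GVert.j '' {(⟨0, by omega⟩ : Fin n3)}ᶜ : Set (GVert n1 n2 n3)).Finite :=
      (Set.toFinite _).image _
    refine ⟨_, (hJfin.insert _).insert _, GGraph.isEdgeMetricGenerator h1 hodd h2 h3, ?_⟩
    rw [Set.ncard_insert_of_notMem (by simp) (hJfin.insert _),
      Set.ncard_insert_of_notMem (by simp) hJfin,
      Set.ncard_image_of_injective _ GGraph.j_injective, Set.ncard_compl, Set.ncard_singleton,
      Nat.card_eq_fintype_card, Fintype.card_fin]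
    omega
  apply le_antisymm (Nat.sInf_le hmem)
  obtain ⟨S, hfin, hS, hcard⟩ := Nat.sInf_mem ⟨_, hmem⟩
  exact (GGraph.le_ncard h1 hodd h2 hfin hS).trans_eq hcard
end
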